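/- arXiv:1804.06869 — 2 statements merged into one kernel-verified Lean document; each statement's English description precedes it below -/
import Mathlib

section
/- There exist absolute constants A > 0 and a > 0 such that for every Q > 1 there exists a function B_Q : O_{4Q} → ℝ satisfying: (i) 0 ≤ B_Q(u,v) ≤ A Q² v for all (u,v) ∈ O_{4Q}; and (ii) for all points x = (u,v), x₊ = (u₊,v₊), x₋ = (u₋,v₋) belonging to O_Q with x = (x₊ + x₋)/2, one has B_Q(x) − (B_Q(x₊) + B_Q(x₋))/2 ≥ a · u · (v₊ − v₋)². -/
noncomputable section

/-- The planar domain `O_Q = {(u,v) : u > 0, v > 0, 1 < uv ≤ Q}`. -/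
def ODom (Q : ℝ) : Set (ℝ × ℝ) :=
  {p | 0 < p.1 ∧ 0 < p.2 ∧ 1 < p.1 * p.2 ∧ p.1 * p.2 ≤ Q}

section

open Real

lemma sub_one_add_sq_le_mul_log {x : ℝ} (hx : 0 < x) (hx2 : x ≤ 2) :
    (x - 1) + (x - 1) ^ 2 / 6 ≤ x * log x := by
  obtain ⟨s, hs, rfl⟩ : ∃ s : ℝ, 0 < s ∧ x = s ^ 2 :=
    ⟨√x, sqrt_pos.2 hx, (sq_sqrt hx.le).symm⟩
  have hlog : s - 1 ≤ s * log s := by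
    have h := mul_le_mul_of_nonneg_left (one_sub_inv_le_log_of_pos hs) hs.le
    rwa [mul_sub, mul_inv_cancel₀ hs.ne', mul_one] at h
  have hs2 : (s + 1) ^ 2 ≤ 6 := by nlinarith [sq_nonneg (s - 3 / 2)]
  rw [log_pow]
  push_cast
  nlinarith [mul_le_mul_of_nonneg_left hlog hs.le,
    mul_le_mul_of_nonneg_left hs2 (sq_nonneg (s - 1))]

lemma sq_log_le_sq_sub_inv_div_two {s : ℝ} (hs : 0 < s) :
    log s ^ 2 ≤ ((s - s⁻¹) / 2) ^ 2 := by
  rw [← sinh_log hs, sq_le_sq, abs_sinh]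
  exact self_le_sinh_iff.2 (abs_nonneg _)

/-- The square of `artanh t` is at most `t² / (1 - t²)`. -/
lemma sq_log_sub_log_le {t : ℝ} (h₁ : 0 < 1 + t) (h₂ : 0 < 1 - t) :
    ((log (1 + t) - log (1 - t)) / 2) ^ 2 ≤ t ^ 2 / (1 - t ^ 2) := by
  have hr : 0 < (1 + t) / (1 - t) := div_pos h₁ h₂
  have hsq := sq_sqrt hr.le
  have hs := sqrt_pos.2 hr
  have h := sq_log_le_sq_sub_inv_div_two hs
  rw [log_sqrt hr.le, log_div h₁.ne' h₂.ne'] at h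
  refine h.trans_eq ?_
  have hid : ((√((1 + t) / (1 - t)) - (√((1 + t) / (1 - t)))⁻¹) / 2) ^ 2
      = ((1 + t) / (1 - t) - 2 + ((1 + t) / (1 - t))⁻¹) / 4 := by
    conv_rhs => rw [← hsq]
    field_simp
    ring
  have h₃ : 1 - t ^ 2 ≠ 0 := by nlinarith [mul_pos h₁ h₂]
  rw [hid]
  field_simp
  ring

lemma neg_le_log_add_log {t : ℝ} (h₁ : 0 < 1 + t) (h₂ : 0 < 1 - t) :
    -(t ^ 2 / (1 - t ^ 2)) ≤ log (1 + t) + log (1 - t) := by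
  have h₃ : 0 < 1 - t ^ 2 := by nlinarith [mul_pos h₁ h₂]
  have h := one_sub_inv_le_log_of_pos (mul_pos h₁ h₂)
  rw [log_mul h₁.ne' h₂.ne', show (1 + t) * (1 - t) = 1 - t ^ 2 by ring] at h
  refine le_trans (le_of_eq ?_) h
  field_simp
  ring

lemma sq_div_twelve_le_of_relative_increments {ξ η k : ℝ} (hξ₁ : 0 < 1 + ξ) (hξ₂ : 0 < 1 - ξ)
    (hη₁ : 0 < 1 + η) (hη₂ : 0 < 1 - η) (hk : 4 ≤ k) :
    η ^ 2 / 12 ≤ k * (ξ ^ 2 / (1 - ξ ^ 2)) +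
      ((1 + η) * (log (1 + ξ) + log (1 + η)) + (1 - η) * (log (1 - ξ) + log (1 - η))) / 2 := by
  have h₁ := sub_one_add_sq_le_mul_log hη₁ (by linarith)
  have h₂ := sub_one_add_sq_le_mul_log hη₂ (by linarith)
  have h₃ := sq_log_sub_log_le hξ₁ hξ₂
  have h₄ := neg_le_log_add_log hξ₁ hξ₂
  have h₅ := mul_le_mul_of_nonneg_right hk (h₃.trans' (sq_nonneg _))
  nlinarith [sq_nonneg (η / 6 + (log (1 + ξ) - log (1 - ξ)) / 2)]

/-- The function `Q² (4 v - 4 / u) - Q v log (u v)`. -/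
def bellman (Q : ℝ) (p : ℝ × ℝ) : ℝ :=
  Q * (4 * Q * (p.2 - 1 / p.1) - p.2 * log (p.1 * p.2))

lemma bellman_nonneg {Q : ℝ} (hQ : 0 < Q) {p : ℝ × ℝ} (hp : p ∈ ODom (4 * Q)) :
    0 ≤ bellman Q p := by
  obtain ⟨hu, hv, h₁, h₂⟩ := hp
  refine mul_nonneg hQ.le (sub_nonneg.2 ?_)
  calc p.2 * log (p.1 * p.2) ≤ p.2 * (p.1 * p.2 - 1) :=
        mul_le_mul_of_nonneg_left (log_le_sub_one_of_pos (by linarith)) hv.le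
    _ = p.1 * p.2 * (p.2 - 1 / p.1) := by field_simp
    _ ≤ 4 * Q * (p.2 - 1 / p.1) := by
        refine mul_le_mul_of_nonneg_right h₂ (sub_nonneg.2 ?_)
        rw [div_le_iff₀ hu]
        linarith

lemma bellman_le {Q : ℝ} (hQ : 0 < Q) {p : ℝ × ℝ} (hp : p ∈ ODom (4 * Q)) :
    bellman Q p ≤ 4 * Q ^ 2 * p.2 := by
  obtain ⟨hu, hv, h₁, -⟩ := hp
  have hlog := mul_nonneg (mul_nonneg hQ.le hv.le) (log_nonneg h₁.le)
  have hinv : 0 ≤ Q ^ 2 * (1 / p.1) := by positivity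
  unfold bellman
  nlinarith

lemma bellman_midpoint_concave {Q u v ξ η : ℝ} (hQ : 0 < Q) (hu : 0 < u) (hv : 0 < v)
    (huv : u * v ≤ Q) (hξ₁ : 0 < 1 + ξ) (hξ₂ : 0 < 1 - ξ) (hη₁ : 0 < 1 + η) (hη₂ : 0 < 1 - η) :
    Q * v * (η ^ 2 / 12) ≤ bellman Q (u, v) -
      (bellman Q (u * (1 + ξ), v * (1 + η)) + bellman Q (u * (1 - ξ), v * (1 - η))) / 2 := by
  have hk : 4 ≤ 4 * Q / (u * v) := by
    rw [le_div_iff₀ (mul_pos hu hv)]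
    linarith
  have h := mul_le_mul_of_nonneg_left
    (sq_div_twelve_le_of_relative_increments hξ₁ hξ₂ hη₁ hη₂ hk) (mul_pos hQ hv).le
  refine h.trans_eq ?_
  have h₃ : 1 - ξ ^ 2 ≠ 0 := by nlinarith [mul_pos hξ₁ hξ₂]
  have hinv : (1 / (u * (1 + ξ)) + 1 / (u * (1 - ξ))) / 2 - 1 / u
      = 1 / u * (ξ ^ 2 / (1 - ξ ^ 2)) := by
    field_simp
    ring
  have hcoef : v * (4 * Q / (u * v)) = 4 * Q * (1 / u) := by field_simp
  simp only [bellman]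
  rw [log_mul (mul_pos hu hξ₁).ne' (mul_pos hv hη₁).ne', log_mul hu.ne' hξ₁.ne',
    log_mul hv.ne' hη₁.ne', log_mul (mul_pos hu hξ₂).ne' (mul_pos hv hη₂).ne',
    log_mul hu.ne' hξ₂.ne', log_mul hv.ne' hη₂.ne', log_mul hu.ne' hv.ne']
  linear_combination Q * (ξ ^ 2 / (1 - ξ ^ 2)) * hcoef - 4 * Q ^ 2 * hinv

end

/-- there are absolute constants `A > 0`, `a > 0` such that for every `Q > 1`
there is a function `B_Q : O_{4Q} → ℝ` with `0 ≤ B_Q(u,v) ≤ A Q² v` on `O_{4Q}`, and the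
midpoint concavity property
`B_Q(x) − (B_Q(x₊)+B_Q(x₋))/2 ≥ a u (v₊ − v₋)²` for all `x, x₊, x₋ ∈ O_Q` with
`x = (x₊+x₋)/2`. -/
theorem bellman_function_exists :
    ∃ A a : ℝ, 0 < A ∧ 0 < a ∧
      ∀ Q : ℝ, 1 < Q →
        ∃ B : ℝ × ℝ → ℝ,
          (∀ p ∈ ODom (4 * Q), 0 ≤ B p ∧ B p ≤ A * Q ^ 2 * p.2) ∧
          (∀ x xp xm : ℝ × ℝ, x ∈ ODom Q → xp ∈ ODom Q → xm ∈ ODom Q →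
            x.1 = (xp.1 + xm.1) / 2 → x.2 = (xp.2 + xm.2) / 2 →
            a * x.1 * (xp.2 - xm.2) ^ 2 ≤ B x - (B xp + B xm) / 2) := by
  refine ⟨4, 1 / 48, by norm_num, by norm_num, fun Q hQ => ⟨bellman Q, fun p hp =>
    ⟨bellman_nonneg (by linarith) hp, bellman_le (by linarith) hp⟩, ?_⟩⟩
  rintro ⟨u, v⟩ ⟨up, vp⟩ ⟨um, vm⟩ ⟨hu, hv, -, huv⟩ ⟨hup, hvp, -, -⟩ ⟨hum, hvm, -, -⟩ h₁ h₂
  dsimp only at *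
  have hQ0 : 0 < Q := by linarith
  obtain ⟨ξ, rfl⟩ : ∃ ξ, up = u * (1 + ξ) := ⟨up / u - 1, by field_simp; ring⟩
  obtain ⟨η, rfl⟩ : ∃ η, vp = v * (1 + η) := ⟨vp / v - 1, by field_simp; ring⟩
  obtain rfl : um = u * (1 - ξ) := by linarith
  obtain rfl : vm = v * (1 - η) := by linarith
  have h := bellman_midpoint_concave hQ0 hu hv huv (pos_of_mul_pos_right hup hu.le)
    (pos_of_mul_pos_right hum hu.le) (pos_of_mul_pos_right hvp hv.le)
    (pos_of_mul_pos_right hvm hv.le)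
  refine le_trans ?_ h
  have hmul := mul_le_mul_of_nonneg_right huv (mul_nonneg hv.le (sq_nonneg η))
  nlinarith
end
end

section
/- There exists an absolute constant A > 0 such that for every Q > 1, every weight w on [0,1) with dyadic A₂ characteristic [w]_{A₂} ≤ Q, every measurable function φ on [0,1) with ∫_0^1 φ² w^{-1} dx < ∞, and every dyadic interval J ⊆ [0,1), one has (1/|J|) Σ_{I ∈ D(J)} (Δ_I (φ w^{-1}))² ⟨w⟩_I |I| ≤ A Q² ⟨φ² w^{-1}⟩_J. Equivalently, the operator S_{w^{-1}} : φ ↦ S(φ w^{-1}) maps L²(w^{-1}) to L²(w) with norm at most A' [w]_{A₂} for an absolute constant A'. -/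
open MeasureTheory

noncomputable section

/-- The dyadic interval `[k/2^n, (k+1)/2^n)`. -/
def dyadicI (n k : ℕ) : Set ℝ := Set.Ico ((k : ℝ) / 2 ^ n) (((k : ℝ) + 1) / 2 ^ n)

/-- The length of a dyadic interval of generation `n`. -/
def dyadicLen (n : ℕ) : ℝ := 1 / 2 ^ n

/-- The average `⟨f⟩_I` of `f` over the dyadic interval `I = (n,k)`. -/
def avg (f : ℝ → ℝ) (n k : ℕ) : ℝ := (2 : ℝ) ^ n * ∫ x in dyadicI n k, f x

/-- The martingale difference `Δ_I f = ⟨f⟩_{I₊} - ⟨f⟩_{I₋}` for `I = (n,k)`. -/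
def haarDiff (f : ℝ → ℝ) (n k : ℕ) : ℝ :=
  avg f (n + 1) (2 * k + 1) - avg f (n + 1) (2 * k)

lemma sq_normalized_increment_le {Q t e h y p m : ℝ} (hQ : 1 ≤ Q) (ht : 0 < t) (htQ : t ≤ Q)
    (he : |e| < 1) (hh : |h| < 1)
    (h₁ : 1 ≤ t * ((1 + e) * (1 + h))) (h₂ : 1 ≤ t * ((1 - e) * (1 - h)))
    (hy : 0 < y) (hyQ : y ^ 2 * (Q * t) = 1)
    (hp : 0 < p) (hm : 0 < m) (hpe : p ^ 2 * (1 + e) = 1 + h) (hme : m ^ 2 * (1 - e) = 1 - h) :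
    (4 * h + t⁻¹ * (1 / (1 - e) - 1 / (1 + e)) + y * (p - m)) ^ 2 ≤
      1536 * Q * (t⁻¹ * ((1 / (1 + e) + 1 / (1 - e)) / 2 - 1) - y * ((p + m) / 2 - 1)) := by
  obtain ⟨he1, he2⟩ := abs_lt.mp he
  obtain ⟨hh1, hh2⟩ := abs_lt.mp hh
  have hE : 0 < 1 - e ^ 2 := by nlinarith
  obtain ⟨g, hg⟩ : ∃ g, g = 1 / (1 - e ^ 2) := ⟨_, rfl⟩
  have hg1 : g * (1 - e ^ 2) = 1 := by rw [hg]; field_simp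
  have hgpos : 0 < g := by rw [hg]; positivity
  have hge : 1 ≤ g := by linarith [mul_nonneg hgpos.le (sq_nonneg e)]
  have hA : 1 / (1 + e) = g * (1 - e) := by
    rw [div_eq_iff (by linarith)]; linarith
  have hB : 1 / (1 - e) = g * (1 + e) := by
    rw [div_eq_iff (by linarith)]; linarith
  obtain ⟨τ, hτ⟩ : ∃ τ, τ = t⁻¹ := ⟨_, rfl⟩
  have hτt : τ * t = 1 := by rw [hτ]; field_simp
  have hτ0 : 0 < τ := by rw [hτ]; positivity
  rw [hA, hB, ← hτ]
  have hgt : g ≤ 2 * t := by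
    have h3 : 1 ≤ t * (2 * (1 - e ^ 2)) := by
      rcases le_total 0 e with h0 | h0
      · have : (1 - e) * (1 - h) ≤ 2 * (1 - e ^ 2) := by nlinarith
        exact h₂.trans (mul_le_mul_of_nonneg_left this ht.le)
      · have : (1 + e) * (1 + h) ≤ 2 * (1 - e ^ 2) := by nlinarith
        exact h₁.trans (mul_le_mul_of_nonneg_left this ht.le)
    calc g = g * 1 := by ring
      _ ≤ g * (t * (2 * (1 - e ^ 2))) := mul_le_mul_of_nonneg_left h3 hgpos.le
      _ = 2 * t := by linear_combination 2 * t * hg1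
  have hgτ : g * τ ≤ 2 := by linarith [mul_le_mul_of_nonneg_right hgt hτ0.le]
  have hQτ : 1 ≤ Q * τ := by linarith [mul_le_mul_of_nonneg_right htQ hτ0.le]
  have hy2 : Q * y ^ 2 = τ := by
    have : Q * y ^ 2 * t = τ * t := by linarith
    exact mul_right_cancel₀ ht.ne' this
  have hyτ : y ≤ τ := by
    refine (sq_le_sq₀ hy.le hτ0.le).1 ?_
    calc y ^ 2 = 1 * y ^ 2 := by ring
      _ ≤ Q * τ * y ^ 2 := mul_le_mul_of_nonneg_right hQτ (sq_nonneg y)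
      _ = τ ^ 2 := by linear_combination τ * hy2
  have hQy : 1 ≤ Q * y := by
    refine (one_le_sq_iff₀ (by positivity)).1 ?_
    calc 1 ≤ Q * τ := hQτ
      _ = (Q * y) ^ 2 := by linear_combination -Q * hy2
  have hp2 : p ^ 2 = g * ((1 + h) * (1 - e)) := by
    rw [← hpe]; linear_combination -p ^ 2 * hg1
  have hm2 : m ^ 2 = g * ((1 - h) * (1 + e)) := by
    rw [← hme]; linear_combination -m ^ 2 * hg1
  have hpm : 0 < p * m := mul_pos hp hm
  have hpm2 : (p * m) ^ 2 = g * (1 - h ^ 2) := by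
    rw [mul_pow, hp2, hm2]; linear_combination g * (1 - h ^ 2) * hg1
  have heg : g * e ^ 2 = g - 1 := by linarith
  have hpmle : p * m ≤ g * (1 - (h ^ 2 + e ^ 2) / 2) := by
    refine (sq_le_sq₀ hpm.le (mul_nonneg hgpos.le (by linarith [(sq_lt_one_iff_abs_lt_one h).2 hh]))).1 ?_
    rw [hpm2]
    have : g * (1 - h ^ 2) = g ^ 2 * ((1 - h ^ 2) * (1 - e ^ 2)) := by
      linear_combination -g * (1 - h ^ 2) * hg1
    rw [this, mul_pow]
    refine mul_le_mul_of_nonneg_left ?_ (sq_nonneg g)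
    linarith [sq_nonneg (h ^ 2 - e ^ 2)]
  have hmid : (p + m) / 2 - 1 ≤ 5 / 8 * (g - 1) - h ^ 2 / 16 := by
    have h3 : ((p + m) / 2) ^ 2 ≤ g - g * (h + e) ^ 2 / 4 := by linarith
    have h4 : (h + e) ^ 2 ≤ g * (h + e) ^ 2 := le_mul_of_one_le_left (sq_nonneg _) hge
    have h5 : h ^ 2 / 2 - (g - 1) ≤ (h + e) ^ 2 := by
      linarith [sq_nonneg (h + 2 * e), le_mul_of_one_le_left (sq_nonneg e) hge]
    linarith [sq_nonneg ((p + m) / 2 - 1)]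
  have hD : h ^ 2 / 16 + 3 / 8 * (τ * (g - 1)) ≤
      Q * (τ * ((g * (1 - e) + g * (1 + e)) / 2 - 1) - y * ((p + m) / 2 - 1)) := by
    have h3 : 3 / 8 * (τ * (g - 1)) + y * (h ^ 2 / 16) ≤
        τ * ((g * (1 - e) + g * (1 + e)) / 2 - 1) - y * ((p + m) / 2 - 1) := by
      linarith [mul_le_mul_of_nonneg_left hmid hy.le,
        mul_le_mul_of_nonneg_right hyτ (sub_nonneg.2 hge)]
    have h4 : h ^ 2 ≤ Q * y * h ^ 2 := le_mul_of_one_le_left (sq_nonneg h) hQy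
    have h5 : τ * (g - 1) ≤ Q * (τ * (g - 1)) :=
      le_mul_of_one_le_left (mul_nonneg hτ0.le (sub_nonneg.2 hge)) hQ
    linarith [mul_le_mul_of_nonneg_left h3 (by linarith : (0 : ℝ) ≤ Q)]
  have hZ : (p - m) ^ 2 ≤ 4 * g ^ 2 * (h - e) ^ 2 := by
    have h3 : (g * (1 - h * e) - p * m) * (g * (1 - h * e) + p * m) = g ^ 2 * (h - e) ^ 2 := by
      linear_combination -hpm2 + g * (1 - h ^ 2) * hg1
    have h4 : 1 / 2 ≤ g * (1 - h * e) := by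
      have : (1 - e ^ 2) / 2 ≤ 1 - h * e := by linarith [sq_nonneg (h - e), (sq_lt_one_iff_abs_lt_one h).2 hh]
      linarith [mul_le_mul_of_nonneg_left this hgpos.le]
    have h5 : (p - m) ^ 2 = 2 * (g * (1 - h * e) - p * m) := by
      linear_combination hp2 + hm2
    have h6 : 0 ≤ g * (1 - h * e) - p * m := by linarith [sq_nonneg (p - m)]
    have h7 : (g * (1 - h * e) - p * m) * (1 / 2) ≤ g ^ 2 * (h - e) ^ 2 := by
      rw [← h3]
      exact mul_le_mul_of_nonneg_left (by linarith) h6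
    linarith
  have hyZ : (y * (p - m)) ^ 2 ≤ 16 * h ^ 2 + 32 * (τ * (g - 1)) := by
    have h3 : Q * (y * (p - m)) ^ 2 ≤ Q * (16 * h ^ 2 + 32 * (τ * (g - 1))) := by
      calc Q * (y * (p - m)) ^ 2 = τ * (p - m) ^ 2 := by rw [← hy2]; ring
        _ ≤ τ * (4 * g ^ 2 * (h - e) ^ 2) := mul_le_mul_of_nonneg_left hZ hτ0.le
        _ = g * τ * (4 * g * (h - e) ^ 2) := by ring
        _ ≤ 2 * (4 * g * (h - e) ^ 2) := mul_le_mul_of_nonneg_right hgτ (by positivity)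
        _ ≤ 2 * (4 * g * (2 * h ^ 2 + 2 * e ^ 2)) := by
          have : (h - e) ^ 2 ≤ 2 * h ^ 2 + 2 * e ^ 2 := by linarith [sq_nonneg (h + e)]
          gcongr
        _ = 16 * (h ^ 2 + h ^ 2 * (g - 1)) + 16 * (g - 1) := by linear_combination 16 * heg
        _ ≤ 16 * h ^ 2 + 32 * (g - 1) := by
          have : h ^ 2 ≤ 1 := ((sq_lt_one_iff_abs_lt_one h).2 hh).le
          linarith [mul_le_mul_of_nonneg_right this (sub_nonneg.2 hge)]
        _ ≤ Q * (16 * h ^ 2 + 32 * (τ * (g - 1))) := by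
          linarith [mul_le_mul_of_nonneg_right hQτ (sub_nonneg.2 hge),
            mul_le_mul_of_nonneg_right hQ (sq_nonneg h)]
    exact le_of_mul_le_mul_left h3 (by linarith)
  have hF : (τ * (g * (1 + e) - g * (1 - e))) ^ 2 ≤ 8 * (τ * (g - 1)) := by
    calc (τ * (g * (1 + e) - g * (1 - e))) ^ 2 = 4 * (g * τ) * (τ * (g * e ^ 2)) := by ring
      _ = 4 * (g * τ) * (τ * (g - 1)) := by rw [heg]
      _ ≤ 4 * 2 * (τ * (g - 1)) := by
        have := mul_nonneg hτ0.le (sub_nonneg.2 hge)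
        gcongr
      _ = _ := by ring
  have hsq : ∀ a b c : ℝ, (a + b + c) ^ 2 ≤ 3 * (a ^ 2 + b ^ 2 + c ^ 2) := fun a b c => by
    linarith [sq_nonneg (a - b), sq_nonneg (b - c), sq_nonneg (a - c)]
  have := mul_nonneg hτ0.le (sub_nonneg.2 hge)
  linarith [hsq (4 * h) (τ * (g * (1 + e) - g * (1 - e))) (y * (p - m)), sq_nonneg h]

lemma sq_sub_le_of_sq_sub_le_mul {L N a b f₁ f₂ : ℝ} (hL : 2 ≤ L) (ha : 0 < a) (hb : 0 < b)
    (hab : (a + b) / 2 ≤ N) (hd : (a - b) ^ 2 ≤ L * N * (N - (a + b) / 2)) :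
    (f₁ - f₂) ^ 2 ≤ 4 * (L + 1) * N *
      ((f₁ ^ 2 / a + f₂ ^ 2 / b) / 2 - ((f₁ + f₂) / 2) ^ 2 / N) := by
  obtain ⟨M, hM⟩ : ∃ M, M = (a + b) / 2 := ⟨_, rfl⟩
  have hM0 : 0 < M := by rw [hM]; positivity
  have hN0 : 0 < N := by linarith
  obtain ⟨f, hf⟩ : ∃ f, f = (f₁ + f₂) / 2 := ⟨_, rfl⟩
  obtain ⟨δ, hδ⟩ : ∃ δ, δ = (f₁ - f₂) / 2 := ⟨_, rfl⟩
  obtain ⟨s, hs⟩ : ∃ s, s = (a - b) / 2 / M := ⟨_, rfl⟩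
  have hsM : s * M = (a - b) / 2 := by rw [hs]; field_simp
  have hs1 : s ^ 2 * M ^ 2 < M ^ 2 := by
    rw [← mul_pow, hsM, hM]; nlinarith [mul_pos ha hb]
  have hs1' : s ^ 2 ≤ 1 := by nlinarith [sq_nonneg M]
  have haM : a = M * (1 + s) := by linarith
  have hbM : b = M * (1 - s) := by linarith
  have hsL : s ^ 2 * N ≤ L * (N - M) := by
    rcases le_total N (2 * M) with h | h
    · have h1 : 4 * (s ^ 2 * M ^ 2) ≤ L * N * (N - M) := by
        rw [← mul_pow, hsM, hM]; nlinarith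
      have h2 : s ^ 2 * N ^ 2 ≤ 4 * (s ^ 2 * M ^ 2) := by
        have : N ^ 2 ≤ (2 * M) ^ 2 := by gcongr
        nlinarith [sq_nonneg s]
      have : N * (s ^ 2 * N) ≤ N * (L * (N - M)) := by linarith
      exact le_of_mul_le_mul_left this hN0
    · nlinarith
  have key : δ ^ 2 ≤ (L + 1) * ((δ - f * s) ^ 2 + f ^ 2 * ((N - M) / N)) := by
    have h1 : s ^ 2 / L ≤ (N - M) / N := by
      rw [div_le_div_iff₀ (by linarith) hN0]; linarith
    have h2 : δ ^ 2 ≤ (L + 1) * ((δ - f * s) ^ 2 + f ^ 2 * (s ^ 2 / L)) := by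
      have : (L + 1) * ((δ - f * s) ^ 2 + f ^ 2 * (s ^ 2 / L)) - δ ^ 2 =
          (L * (δ - f * s) - f * s) ^ 2 / L := by
        field_simp; ring
      have h3 : 0 ≤ (L * (δ - f * s) - f * s) ^ 2 / L := by positivity
      linarith
    refine h2.trans ?_
    gcongr
  have hs3 : 0 < 1 + s := by
    by_contra! h; nlinarith
  have hs4 : 0 < 1 - s := by
    by_contra! h; nlinarith
  have h5 : (δ - f * s) ^ 2 / M + f ^ 2 / M ≤ (f₁ ^ 2 / a + f₂ ^ 2 / b) / 2 := by
    have e1 : f₁ = f + δ := by linarith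
    have e2 : f₂ = f - δ := by linarith
    have : (f₁ ^ 2 / a + f₂ ^ 2 / b) / 2 - ((δ - f * s) ^ 2 / M + f ^ 2 / M) =
        s ^ 2 * (δ - f * s) ^ 2 / (M * (1 + s) * (1 - s)) := by
      rw [haM, hbM, e1, e2]; field_simp; ring
    have h3 : 0 ≤ s ^ 2 * (δ - f * s) ^ 2 / (M * (1 + s) * (1 - s)) := by positivity
    linarith
  have h6 : ((δ - f * s) ^ 2 + f ^ 2 * ((N - M) / N)) / N ≤
      (f₁ ^ 2 / a + f₂ ^ 2 / b) / 2 - f ^ 2 / N := by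
    have h7 : ((δ - f * s) ^ 2 + f ^ 2 * ((N - M) / N)) / M =
      (δ - f * s) ^ 2 / M + f ^ 2 / M - f ^ 2 / N := by field_simp; ring
    have h8 : 0 ≤ (N - M) / N := div_nonneg (by linarith) hN0.le
    have h9 : ((δ - f * s) ^ 2 + f ^ 2 * ((N - M) / N)) / N ≤
      ((δ - f * s) ^ 2 + f ^ 2 * ((N - M) / N)) / M := by
      gcongr
      linarith
    linarith
  rw [← hf]
  rw [div_le_iff₀ hN0] at h6
  have : (f₁ - f₂) ^ 2 = 4 * δ ^ 2 := by rw [hδ]; ring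
  nlinarith [mul_le_mul_of_nonneg_left h6 (by linarith : 0 ≤ L + 1)]

/-- An auxiliary function comparable to `v` whose concavity on `1 ≤ u v ≤ Q` is quantitative. -/
def concaveMajorant (Q u v : ℝ) : ℝ := 2 * v - u⁻¹ + √(v / (Q * u))

lemma le_concaveMajorant {Q u v : ℝ} (hu : 0 < u) (h : 1 ≤ u * v) :
    v ≤ concaveMajorant Q u v := by
  have : u⁻¹ ≤ v := by rw [inv_le_iff_one_le_mul₀ hu]; linarith
  have := Real.sqrt_nonneg (v / (Q * u))
  unfold concaveMajorant
  linarith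

lemma concaveMajorant_le {Q u v : ℝ} (hQ : 1 ≤ Q) (hu : 0 < u) (hv : 0 < v) (h : 1 ≤ u * v) :
    concaveMajorant Q u v ≤ 3 * v := by
  have h1 : 0 < u⁻¹ := by positivity
  have h2 : √(v / (Q * u)) ≤ v := by
    rw [Real.sqrt_le_left hv.le, div_le_iff₀ (by positivity)]
    have : 1 ≤ Q * (u * v) := one_le_mul_of_one_le_of_one_le hQ h
    calc v ≤ v * (Q * (u * v)) := le_mul_of_one_le_right hv.le this
      _ = v ^ 2 * (Q * u) := by ring
  unfold concaveMajorant
  linarith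

lemma sq_sub_concaveMajorant_le {Q u₁ v₁ u₂ v₂ u v : ℝ} (hQ : 1 ≤ Q)
    (hu₁ : 0 < u₁) (hv₁ : 0 < v₁) (hu₂ : 0 < u₂) (hv₂ : 0 < v₂)
    (hu : u = (u₁ + u₂) / 2) (hv : v = (v₁ + v₂) / 2)
    (h₁ : 1 ≤ u₁ * v₁) (h₂ : 1 ≤ u₂ * v₂) (h : u * v ≤ Q) :
    (concaveMajorant Q u₁ v₁ - concaveMajorant Q u₂ v₂) ^ 2 ≤ 1536 * Q * v *
      (concaveMajorant Q u v - (concaveMajorant Q u₁ v₁ + concaveMajorant Q u₂ v₂) / 2) := by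
  have hu0 : 0 < u := by rw [hu]; positivity
  have hv0 : 0 < v := by rw [hv]; positivity
  have hQ0 : 0 < Q := by linarith
  obtain ⟨e, he⟩ : ∃ e, e = (u₁ - u₂) / 2 / u := ⟨_, rfl⟩
  obtain ⟨d, hd⟩ : ∃ d, d = (v₁ - v₂) / 2 / v := ⟨_, rfl⟩
  have heu : e * u = (u₁ - u₂) / 2 := by rw [he]; field_simp
  have hdv : d * v = (v₁ - v₂) / 2 := by rw [hd]; field_simp
  have e1 : u₁ = u * (1 + e) := by linarith
  have e2 : u₂ = u * (1 - e) := by linarith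
  have d1 : v₁ = v * (1 + d) := by linarith
  have d2 : v₂ = v * (1 - d) := by linarith
  have e1' : 0 < 1 + e := pos_of_mul_pos_right (e1 ▸ hu₁) hu0.le
  have e2' : 0 < 1 - e := pos_of_mul_pos_right (e2 ▸ hu₂) hu0.le
  have d1' : 0 < 1 + d := pos_of_mul_pos_right (d1 ▸ hv₁) hv0.le
  have d2' : 0 < 1 - d := pos_of_mul_pos_right (d2 ▸ hv₂) hv0.le
  obtain ⟨X, hX⟩ : ∃ X, X = √(v / (Q * u)) := ⟨_, rfl⟩
  obtain ⟨X₁, hX₁⟩ : ∃ X, X = √(v₁ / (Q * u₁)) := ⟨_, rfl⟩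
  obtain ⟨X₂, hX₂⟩ : ∃ X, X = √(v₂ / (Q * u₂)) := ⟨_, rfl⟩
  have hX0 : 0 < X := by rw [hX]; positivity
  have hX₁0 : 0 < X₁ := by rw [hX₁]; positivity
  have hX₂0 : 0 < X₂ := by rw [hX₂]; positivity
  have hXs : X ^ 2 = v / (Q * u) := by rw [hX, Real.sq_sqrt (by positivity)]
  have hX₁s : X₁ ^ 2 = v₁ / (Q * u₁) := by rw [hX₁, Real.sq_sqrt (by positivity)]
  have hX₂s : X₂ ^ 2 = v₂ / (Q * u₂) := by rw [hX₂, Real.sq_sqrt (by positivity)]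
  have key := sq_normalized_increment_le (Q := Q) (t := u * v) (e := e) (h := d) (y := X / v) (p := X₁ / X) (m := X₂ / X)
    hQ (by positivity) h (abs_lt.2 ⟨by linarith, by linarith⟩)
    (abs_lt.2 ⟨by linarith, by linarith⟩) (by rw [e1, d1] at h₁; linarith)
    (by rw [e2, d2] at h₂; linarith) (by positivity)
    (by rw [div_pow, hXs]; field_simp) (by positivity) (by positivity)
    (by rw [div_pow, hXs, hX₁s, e1, d1]; field_simp)
    (by rw [div_pow, hXs, hX₂s, e2, d2]; field_simp)
  have hS : concaveMajorant Q u₁ v₁ - concaveMajorant Q u₂ v₂ =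
      v * (4 * d + (u * v)⁻¹ * (1 / (1 - e) - 1 / (1 + e)) + X / v * (X₁ / X - X₂ / X)) := by
    unfold concaveMajorant
    rw [← hX₁, ← hX₂, e1, e2, d1, d2]
    field_simp
    ring
  have hD : concaveMajorant Q u v - (concaveMajorant Q u₁ v₁ + concaveMajorant Q u₂ v₂) / 2 =
      v * ((u * v)⁻¹ * ((1 / (1 + e) + 1 / (1 - e)) / 2 - 1) -
        X / v * ((X₁ / X + X₂ / X) / 2 - 1)) := by
    unfold concaveMajorant
    rw [← hX₁, ← hX₂, ← hX, e1, e2, d1, d2]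
    field_simp
    ring
  rw [hS, hD, mul_pow]
  calc _ ≤ v ^ 2 * _ := mul_le_mul_of_nonneg_left key (sq_nonneg v)
    _ = _ := by ring

lemma sq_sub_mul_le_div_concaveMajorant {Q u₁ v₁ u₂ v₂ u v f₁ f₂ f : ℝ} (hQ : 1 ≤ Q)
    (hu₁ : 0 < u₁) (hv₁ : 0 < v₁) (hu₂ : 0 < u₂) (hv₂ : 0 < v₂)
    (hu : u = (u₁ + u₂) / 2) (hv : v = (v₁ + v₂) / 2) (hf : f = (f₁ + f₂) / 2)
    (h₁ : 1 ≤ u₁ * v₁) (h₂ : 1 ≤ u₂ * v₂) (h₀ : 1 ≤ u * v) (h : u * v ≤ Q) :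
    (f₁ - f₂) ^ 2 * u ≤ 18444 * Q ^ 2 *
      ((f₁ ^ 2 / concaveMajorant Q u₁ v₁ + f₂ ^ 2 / concaveMajorant Q u₂ v₂) / 2
        - f ^ 2 / concaveMajorant Q u v) := by
  have hu0 : 0 < u := by rw [hu]; positivity
  have hv0 : 0 < v := by rw [hv]; positivity
  have hd := sq_sub_concaveMajorant_le hQ hu₁ hv₁ hu₂ hv₂ hu hv h₁ h₂ h
  have ha := hv₁.trans_le (le_concaveMajorant (Q := Q) hu₁ h₁)
  have hb := hv₂.trans_le (le_concaveMajorant (Q := Q) hu₂ h₂)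
  have hN := le_concaveMajorant (Q := Q) hu0 h₀
  have hN' := concaveMajorant_le hQ hu0 hv0 h₀
  generalize concaveMajorant Q u₁ v₁ = a at *
  generalize concaveMajorant Q u₂ v₂ = b at *
  generalize concaveMajorant Q u v = N at *
  have hD : 0 ≤ N - (a + b) / 2 :=
    nonneg_of_mul_nonneg_right ((sq_nonneg _).trans hd) (by positivity)
  have hG := sq_sub_le_of_sq_sub_le_mul (L := 1536 * Q) (N := N) (f₁ := f₁) (f₂ := f₂) (by linarith) ha hb (by linarith)
    (hd.trans (by gcongr))
  rw [← hf] at hG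
  have hN0 : 0 < N := by linarith
  generalize (f₁ ^ 2 / a + f₂ ^ 2 / b) / 2 - f ^ 2 / N = G at *
  have hG0 : 0 ≤ G := nonneg_of_mul_nonneg_right ((sq_nonneg _).trans hG) (by positivity)
  have huN : u * N ≤ 3 * Q := by
    linarith [mul_le_mul_of_nonneg_left hN' hu0.le]
  calc (f₁ - f₂) ^ 2 * u ≤ 4 * (1536 * Q + 1) * N * G * u := by gcongr
    _ = 4 * (1536 * Q + 1) * (u * N) * G := by ring
    _ ≤ 4 * (1536 * Q + Q) * (3 * Q) * G := by gcongr
    _ = _ := by ring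

lemma sum_dyadic_tree_le {a B : ℕ → ℕ → ℝ}
    (hB : ∀ n k, k < 2 ^ n → 0 ≤ B n k)
    (hstep : ∀ n k, k < 2 ^ n → a n k + (B (n + 1) (2 * k) + B (n + 1) (2 * k + 1)) ≤ B n k)
    (N n k : ℕ) (hk : k < 2 ^ n) :
    ∑ p ∈ Finset.range N, ∑ r ∈ Finset.range (2 ^ p), a (n + p) (2 ^ p * k + r) ≤ B n k := by
  induction N generalizing n k with
  | zero => simpa using hB n k hk
  | succ N ih =>
    rw [Finset.sum_range_succ']
    have h1 := ih (n + 1) (2 * k) (by rw [pow_succ]; omega)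
    have h2 := ih (n + 1) (2 * k + 1) (by rw [pow_succ]; omega)
    have h3 : ∀ p, ∑ r ∈ Finset.range (2 ^ (p + 1)), a (n + (p + 1)) (2 ^ (p + 1) * k + r) =
        ∑ r ∈ Finset.range (2 ^ p), a (n + 1 + p) (2 ^ p * (2 * k) + r) +
          ∑ r ∈ Finset.range (2 ^ p), a (n + 1 + p) (2 ^ p * (2 * k + 1) + r) := by
      intro p
      rw [show 2 ^ (p + 1) = 2 ^ p + 2 ^ p by ring, Finset.sum_range_add,
        show n + (p + 1) = n + 1 + p by ring]
      congr 1 <;> refine Finset.sum_congr rfl fun r _ => ?_ <;> congr 1 <;> ring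
    simp only [h3, Finset.sum_add_distrib]
    have := hstep n k hk
    simp only [pow_zero, Finset.range_one, Finset.sum_singleton, add_zero, one_mul]
    linarith

lemma measurableSet_dyadicI (n k : ℕ) : MeasurableSet (dyadicI n k) := measurableSet_Ico

lemma dyadicI_subset {n k : ℕ} (hk : k < 2 ^ n) : dyadicI n k ⊆ Set.Ico 0 1 := by
  refine Set.Ico_subset_Ico (by positivity) ?_
  rw [div_le_one (by positivity)]
  exact_mod_cast hk

lemma volume_real_dyadicI (n k : ℕ) : volume.real (dyadicI n k) = 1 / 2 ^ n := by
  rw [dyadicI, Real.volume_real_Ico_of_le (by gcongr; linarith)]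
  ring

lemma avg_eq_half_add {g : ℝ → ℝ} (hg : IntegrableOn g (Set.Ico 0 1)) {n k : ℕ} (hk : k < 2 ^ n) :
    avg g n k = (avg g (n + 1) (2 * k) + avg g (n + 1) (2 * k + 1)) / 2 := by
  have h0 : k / 2 ^ n = ((2 * k : ℕ) : ℝ) / 2 ^ (n + 1) := by
    push_cast; rw [pow_succ]; field_simp
  have h1 : ((2 * k + 1 : ℕ) : ℝ) / 2 ^ (n + 1) = (((2 * k : ℕ) : ℝ) + 1) / 2 ^ (n + 1) := by
    push_cast; rfl
  have h2 : ((k : ℝ) + 1) / 2 ^ n = (((2 * k + 1 : ℕ) : ℝ) + 1) / 2 ^ (n + 1) := by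
    push_cast; field_simp; ring
  have hunion : dyadicI n k = dyadicI (n + 1) (2 * k) ∪ dyadicI (n + 1) (2 * k + 1) := by
    unfold dyadicI
    rw [h0, h1, h2, Set.Ico_union_Ico_eq_Ico]
    · gcongr; linarith
    · rw [← h1]; gcongr; linarith
  have hdisj : Disjoint (dyadicI (n + 1) (2 * k)) (dyadicI (n + 1) (2 * k + 1)) := by
    unfold dyadicI
    rw [h1]
    exact Set.Ico_disjoint_Ico_same
  have hint := hg.mono_set (dyadicI_subset hk)
  rw [hunion] at hint
  unfold avg
  rw [hunion, setIntegral_union hdisj (measurableSet_dyadicI _ _)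
    (hint.mono_set Set.subset_union_left) (hint.mono_set Set.subset_union_right)]
  ring

lemma avg_pos {g : ℝ → ℝ} (hg : IntegrableOn g (Set.Ico 0 1))
    (hpos : ∀ x ∈ Set.Ico (0 : ℝ) 1, 0 < g x) {n k : ℕ} (hk : k < 2 ^ n) : 0 < avg g n k := by
  have hsub := dyadicI_subset hk
  have hvol : volume (dyadicI n k) ≠ 0 := by
    intro h
    have := volume_real_dyadicI n k
    rw [measureReal_def, h, ENNReal.toReal_zero] at this
    exact (by positivity : (0 : ℝ) < 1 / 2 ^ n).ne this
  refine mul_pos (by positivity) ?_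
  rw [setIntegral_pos_iff_support_of_nonneg_ae
    ((ae_restrict_iff' (measurableSet_dyadicI n k)).2 (.of_forall fun x hx => (hpos x (hsub hx)).le))
    (hg.mono_set hsub)]
  have : dyadicI n k ⊆ Function.support g := fun x hx => (hpos x (hsub hx)).ne'
  rw [Set.inter_eq_right.2 this]
  exact pos_iff_ne_zero.2 hvol

lemma integrableOn_mul_of_sq_mul {φ v : ℝ → ℝ} {s : Set ℝ} (hs : MeasurableSet s)
    (hφ : Measurable φ) (hv : Measurable v) (hpos : ∀ x ∈ s, 0 < v x)
    (hvi : IntegrableOn v s) (hφi : IntegrableOn (fun x => φ x ^ 2 * v x) s) :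
    IntegrableOn (fun x => φ x * v x) s := by
  refine Integrable.mono' (hφi.add hvi) (hφ.mul hv).aestronglyMeasurable ?_
  refine (ae_restrict_iff' hs).2 (.of_forall fun x hx => ?_)
  have := hpos x hx
  rw [Real.norm_eq_abs, abs_mul, abs_of_pos this]
  have h1 : |φ x| ≤ φ x ^ 2 + 1 := by
    rw [← sq_abs]; nlinarith [sq_nonneg (|φ x| - 1), abs_nonneg (φ x)]
  calc |φ x| * v x ≤ (φ x ^ 2 + 1) * v x := by gcongr
    _ = _ := by simp only [Pi.add_apply]; ring

/-- Cauchy–Schwarz for averages over dyadic intervals. -/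
lemma sq_avg_mul_le {φ v : ℝ → ℝ} (hpos : ∀ x ∈ Set.Ico (0 : ℝ) 1, 0 < v x)
    (hvi : IntegrableOn v (Set.Ico 0 1))
    (hφi : IntegrableOn (fun x => φ x ^ 2 * v x) (Set.Ico 0 1))
    (hφv : IntegrableOn (fun x => φ x * v x) (Set.Ico 0 1)) {n k : ℕ} (hk : k < 2 ^ n) :
    avg (fun x => φ x * v x) n k ^ 2 ≤ avg (fun x => φ x ^ 2 * v x) n k * avg v n k := by
  have hsub := dyadicI_subset hk
  have hv := avg_pos hvi hpos hk
  have key : ∀ c : ℝ, 0 ≤ avg (fun x => φ x ^ 2 * v x) n k -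
      2 * c * avg (fun x => φ x * v x) n k + c ^ 2 * avg v n k := by
    intro c
    have h1 : 0 ≤ ∫ x in dyadicI n k, (φ x - c) ^ 2 * v x :=
      setIntegral_nonneg (measurableSet_dyadicI n k) fun x hx =>
        mul_nonneg (sq_nonneg _) (hpos x (hsub hx)).le
    have h2 : ∫ x in dyadicI n k, (φ x - c) ^ 2 * v x =
        (∫ x in dyadicI n k, φ x ^ 2 * v x) - 2 * c * (∫ x in dyadicI n k, φ x * v x) +
          c ^ 2 * ∫ x in dyadicI n k, v x := by
      rw [← integral_const_mul, ← integral_const_mul, ← integral_sub, ← integral_add]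
      · exact integral_congr_ae (.of_forall fun x => by ring)
      · exact (hφi.mono_set hsub).sub ((hφv.mono_set hsub).const_mul _)
      · exact (hvi.mono_set hsub).const_mul _
      · exact hφi.mono_set hsub
      · exact (hφv.mono_set hsub).const_mul _
    rw [h2] at h1
    unfold avg
    have := mul_nonneg (by positivity : (0 : ℝ) ≤ 2 ^ n) h1
    linarith
  have h := key (avg (fun x => φ x * v x) n k / avg v n k)
  generalize avg (fun x => φ x * v x) n k = f at *
  generalize avg v n k = g at *
  have h3 : 2 * (f / g) * f - (f / g) ^ 2 * g = f ^ 2 / g := by field_simp; ring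
  rw [← div_le_iff₀ hv]
  linarith

lemma one_le_avg_mul_avg_inv {w : ℝ → ℝ} (hw : ∀ x ∈ Set.Ico (0 : ℝ) 1, 0 < w x)
    (hwi : IntegrableOn w (Set.Ico 0 1))
    (hwi' : IntegrableOn (fun x => (w x)⁻¹) (Set.Ico 0 1)) {n k : ℕ} (hk : k < 2 ^ n) :
    1 ≤ avg w n k * avg (fun x => (w x)⁻¹) n k := by
  have hsub := dyadicI_subset hk
  have h1 : Set.EqOn (fun x => w x ^ 2 * (w x)⁻¹) w (Set.Ico 0 1) := fun x hx => by
    have := (hw x hx).ne'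
    simp only
    field_simp
  have h2 : Set.EqOn (fun x => w x * (w x)⁻¹) (fun _ => 1) (Set.Ico 0 1) := fun x hx =>
    mul_inv_cancel₀ (hw x hx).ne'
  have h := sq_avg_mul_le (φ := w) (fun x hx => inv_pos.2 (hw x hx)) hwi'
    (hwi.congr_fun h1.symm measurableSet_Ico)
    ((integrableOn_const (by simp)).congr_fun h2.symm measurableSet_Ico) hk
  have e1 : avg (fun x => w x ^ 2 * (w x)⁻¹) n k = avg w n k := by
    unfold avg
    rw [setIntegral_congr_fun (measurableSet_dyadicI n k) (h1.mono hsub)]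
  have e2 : avg (fun x => w x * (w x)⁻¹) n k = 1 := by
    unfold avg
    rw [setIntegral_congr_fun (measurableSet_dyadicI n k) (h2.mono hsub), setIntegral_const,
      volume_real_dyadicI, smul_eq_mul]
    field_simp
  rw [e1, e2] at h
  linarith

/-- there is an absolute constant `A > 0` such that for every `Q > 1`, every
weight `w` on `[0,1)` with `[w]_{A₂} ≤ Q`, every `φ` with `∫ φ² w⁻¹ < ∞`, and every dyadic
interval `J = (n,k)`,
`(1/|J|) Σ_{I ∈ D(J)} (Δ_I (φ w⁻¹))² ⟨w⟩_I |I| ≤ A Q² ⟨φ² w⁻¹⟩_J`;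
i.e. `S_{w⁻¹} : L²(w⁻¹) → L²(w)` has norm at most `A' [w]_{A₂}`.  (The sum over `D(J)` is
expressed through all its finite partial sums over generations `p < N`.) -/
theorem strong_weighted_estimate_squareFunction :
    ∃ A : ℝ, 0 < A ∧
      ∀ Q : ℝ, 1 < Q →
      ∀ w : ℝ → ℝ, Measurable w →
        (∀ x ∈ Set.Ico (0 : ℝ) 1, 0 < w x) →
        IntegrableOn w (Set.Ico (0 : ℝ) 1) →
        IntegrableOn (fun x => (w x)⁻¹) (Set.Ico (0 : ℝ) 1) →
        (∀ n k : ℕ, k < 2 ^ n →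
          avg w n k * avg (fun x => (w x)⁻¹) n k ≤ Q) →
        ∀ φ : ℝ → ℝ, Measurable φ →
          IntegrableOn (fun x => φ x ^ 2 * (w x)⁻¹) (Set.Ico (0 : ℝ) 1) →
        ∀ n k : ℕ, k < 2 ^ n → ∀ N : ℕ,
          (1 / dyadicLen n) *
            ∑ p ∈ Finset.range N, ∑ r ∈ Finset.range (2 ^ p),
              (haarDiff (fun x => φ x * (w x)⁻¹) (n + p) (2 ^ p * k + r)) ^ 2 *
                avg w (n + p) (2 ^ p * k + r) * dyadicLen (n + p)
          ≤ A * Q ^ 2 * avg (fun x => φ x ^ 2 * (w x)⁻¹) n k := by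
  refine ⟨18444, by norm_num, fun Q hQ w hwm hw hwi hwi' hA₂ φ hφ hφi n k hk N => ?_⟩
  have hσ : ∀ x ∈ Set.Ico (0 : ℝ) 1, 0 < (w x)⁻¹ := fun x hx => inv_pos.2 (hw x hx)
  have hf : IntegrableOn (fun x => φ x * (w x)⁻¹) (Set.Ico 0 1) :=
    integrableOn_mul_of_sq_mul measurableSet_Ico hφ hwm.inv hσ hwi' hφi
  let B : ℕ → ℕ → ℝ := fun n k => 18444 * Q ^ 2 * (avg (fun x => φ x ^ 2 * (w x)⁻¹) n k -
    avg (fun x => φ x * (w x)⁻¹) n k ^ 2 /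
      concaveMajorant Q (avg w n k) (avg (fun x => (w x)⁻¹) n k)) * dyadicLen n
  have hlen : ∀ n, 0 < dyadicLen n := fun n => by unfold dyadicLen; positivity
  have hB : ∀ n k, k < 2 ^ n → 0 ≤ B n k := by
    intro n k hk
    have hv := avg_pos hwi' hσ hk
    have hN := le_concaveMajorant (Q := Q) (avg_pos hwi hw hk)
      (one_le_avg_mul_avg_inv hw hwi hwi' hk)
    have hF : 0 ≤ avg (fun x => φ x ^ 2 * (w x)⁻¹) n k := nonneg_of_mul_nonneg_left
      ((sq_nonneg _).trans (sq_avg_mul_le hσ hwi' hφi hf hk)) hv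
    refine mul_nonneg (mul_nonneg (by positivity) (sub_nonneg.2 ?_)) (hlen n).le
    rw [div_le_iff₀ (hv.trans_le hN)]
    exact (sq_avg_mul_le hσ hwi' hφi hf hk).trans (mul_le_mul_of_nonneg_left hN hF)
  have hstep : ∀ n k, k < 2 ^ n →
      haarDiff (fun x => φ x * (w x)⁻¹) n k ^ 2 * avg w n k * dyadicLen n +
        (B (n + 1) (2 * k) + B (n + 1) (2 * k + 1)) ≤ B n k := by
    intro n k hk
    have hk₂ : 2 * k + 1 < 2 ^ (n + 1) := by rw [pow_succ]; omega
    have hk₁ : 2 * k < 2 ^ (n + 1) := by omega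
    have h := sq_sub_mul_le_div_concaveMajorant hQ.le
      (avg_pos hwi hw hk₁) (avg_pos hwi' hσ hk₁) (avg_pos hwi hw hk₂) (avg_pos hwi' hσ hk₂)
      (avg_eq_half_add hwi hk) (avg_eq_half_add hwi' hk) (avg_eq_half_add hf hk)
      (one_le_avg_mul_avg_inv hw hwi hwi' hk₁) (one_le_avg_mul_avg_inv hw hwi hwi' hk₂)
      (one_le_avg_mul_avg_inv hw hwi hwi' hk) (hA₂ n k hk)
    have hhalf : dyadicLen (n + 1) = dyadicLen n / 2 := by
      unfold dyadicLen; rw [pow_succ]; field_simp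
    have hF := avg_eq_half_add hφi hk
    simp only [B, hhalf, hF]
    unfold haarDiff
    linarith [mul_le_mul_of_nonneg_right h (hlen n).le]
  have hsum := sum_dyadic_tree_le hB hstep N n k hk
  rw [one_div_mul_eq_div, div_le_iff₀ (hlen n)]
  refine hsum.trans (mul_le_mul_of_nonneg_right ?_ (hlen n).le)
  refine mul_le_mul_of_nonneg_left (sub_le_self _ (div_nonneg (sq_nonneg _) ?_)) (by positivity)
  exact (avg_pos hwi' hσ hk).le.trans (le_concaveMajorant (avg_pos hwi hw hk)
    (one_le_avg_mul_avg_inv hw hwi hwi' hk))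
end
end
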